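/- Let r > 0 and let φ be a real number with 0 < φ < π/2, and set Q(x) = x² − 2r·cos(φ)·x + r². Then there exists a nonzero polynomial Q₁ with real coefficients such that Q₁ has positive coefficients and the product Q·Q₁ has positive coefficients. -/

import Mathlib

open Polynomial

/-- A real polynomial has positive coefficients if every coefficient in degrees
`0` through its degree is strictly positive. -/
def PosCoeffs (p : Polynomial ℝ) : Prop := ∀ i ≤ p.natDegree, 0 < p.coeff i

/-- Consecutive binomial coefficients of a large order satisfy a strict three-term inequality. -/
lemma choose_three_term_pos (c : ℝ) (hc : 0 ≤ c) (j l : ℕ)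
    (h : 2 < (1 - c) * (j + l + 3)) :
    0 < ((j + 1 + l).choose j : ℝ) - 2 * c * (j + 1 + l).choose (j + 1)
      + (j + 1 + l).choose (j + 2) := by
  have hA : ((j + 1 + l).choose (j + 1) : ℝ) * (j + 1) = (j + 1 + l).choose j * (l + 1) := by
    have := Nat.choose_succ_right_eq (j + 1 + l) j
    rw [show j + 1 + l - j = l + 1 by omega] at this
    exact_mod_cast this
  have hD : ((j + 1 + l).choose (j + 2) : ℝ) * (j + 2) = (j + 1 + l).choose (j + 1) * l := by
    have := Nat.choose_succ_right_eq (j + 1 + l) (j + 1)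
    rw [show j + 1 + l - (j + 1) = l by omega] at this
    exact_mod_cast this
  have hB : (0 : ℝ) < (j + 1 + l).choose (j + 1) := by
    exact_mod_cast Nat.choose_pos (by omega)
  generalize ((j + 1 + l).choose j : ℝ) = A at *
  generalize ((j + 1 + l).choose (j + 1) : ℝ) = B at *
  generalize ((j + 1 + l).choose (j + 2) : ℝ) = D at *
  have hj : (0 : ℝ) ≤ j := j.cast_nonneg
  have hl : (0 : ℝ) ≤ l := l.cast_nonneg
  generalize (j : ℝ) = x at *
  generalize (l : ℝ) = y at *
  have key : 0 < (x + 1) * (x + 2) + y * (y + 1) - 2 * c * ((x + 2) * (y + 1)) := by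
    have h₁ : 2 * (x + y + 3) < (1 - c) * (x + y + 3) * (x + y + 3) :=
      mul_lt_mul_of_pos_right h (by linarith)
    nlinarith [mul_nonneg hc (sq_nonneg (x - y + 1)), sq_nonneg (x - y + 1)]
  have hmul : (A - 2 * c * B + D) * ((x + 2) * (y + 1))
      = B * ((x + 1) * (x + 2) + y * (y + 1) - 2 * c * ((x + 2) * (y + 1))) := by
    linear_combination -(x + 2) * hA + (y + 1) * hD
  have hpos : 0 < (A - 2 * c * B + D) * ((x + 2) * (y + 1)) := hmul ▸ mul_pos hB key
  exact pos_of_mul_pos_left hpos (by positivity)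

lemma posCoeffs_X_add_C_pow (r : ℝ) (hr : 0 < r) (n : ℕ) : PosCoeffs ((X + C r) ^ n) := by
  intro i hi
  rw [natDegree_pow, natDegree_X_add_C, mul_one] at hi
  have : (0 : ℝ) < n.choose i := by exact_mod_cast Nat.choose_pos hi
  rw [coeff_X_add_C_pow]
  positivity

lemma posCoeffs_quadratic_mul_X_add_C_pow (r c : ℝ) (hr : 0 < r) (hc : 0 ≤ c) (n : ℕ)
    (hn : 2 < (1 - c) * (n + 2)) :
    PosCoeffs ((X ^ 2 - C (2 * r * c) * X + C (r ^ 2)) * (X + C r) ^ n) := by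
  have hc₁ : c < 1 := by
    by_contra! h
    nlinarith [n.cast_nonneg (α := ℝ)]
  have hdeg : ((X ^ 2 - C (2 * r * c) * X + C (r ^ 2)) * (X + C r) ^ n).natDegree ≤ n + 2 := by
    compute_degree
    omega
  intro i hi
  have hi' := hi.trans hdeg
  rw [add_mul, sub_mul, coeff_add, coeff_sub, mul_assoc, coeff_C_mul, coeff_C_mul]
  obtain _ | _ | j := i
  · have : 0 < r ^ 2 * r ^ n := by positivity
    simpa [coeff_X_add_C_pow, coeff_X_pow_mul'] using this
  · have hn₁ : 2 * c < n := by nlinarith [n.cast_nonneg (α := ℝ)]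
    obtain _ | n := n
    · simp at hn₁
      linarith
    · have : 0 < r ^ (n + 2) * ((n + 1 : ℕ) - 2 * c) := by
        have : 0 < ((n + 1 : ℕ) : ℝ) - 2 * c := by linarith
        positivity
      rw [coeff_X_pow_mul', zero_add, coeff_X_mul, coeff_X_add_C_pow, coeff_X_add_C_pow]
      simp only [Nat.choose_one_right, Nat.add_sub_cancel]
      norm_num at this ⊢
      linear_combination this
  · rw [coeff_X_pow_mul, coeff_X_mul, coeff_X_add_C_pow, coeff_X_add_C_pow, coeff_X_add_C_pow]
    obtain rfl | hj : j = n ∨ j < n := by omega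
    · simp [Nat.choose_eq_zero_of_lt (show j < j + 1 + 1 by omega)]
    · obtain ⟨l, rfl⟩ := Nat.exists_eq_add_of_le (Nat.succ_le_of_lt hj)
      rw [Nat.succ_eq_add_one] at *
      have h := choose_three_term_pos c hc j l (by push_cast at hn; linarith)
      have hpos := mul_pos (pow_pos hr (l + 1)) h
      have h₀ : j + 1 + l - j = l + 1 := by omega
      have h₁ : j + 1 + l - (j + 1) = l := by omega
      have h₂ : r ^ 2 * (r ^ (j + 1 + l - (j + 2)) * ((j + 1 + l).choose (j + 2) : ℝ))
          = r ^ (l + 1) * (j + 1 + l).choose (j + 2) := by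
        obtain _ | l := l
        · simp
        · rw [show j + 1 + (l + 1) - (j + 2) = l by omega]
          ring
      rw [h₀, h₁, show j + 1 + 1 = j + 2 from rfl, h₂]
      linear_combination hpos

/-- For `r > 0` and `0 < φ < π/2`, the irreducible quadratic
`Q(x) = x² − 2r·cos(φ)·x + r²` (with roots `r·e^{±iφ}`) admits a nonzero multiplier `Q₁`
with positive coefficients such that `Q·Q₁` also has positive coefficients. -/
theorem quadratic_positive_representation (r φ : ℝ) (hr : 0 < r)
    (hφ₀ : 0 < φ) (hφ₁ : φ < Real.pi / 2) :
    ∃ Q₁ : Polynomial ℝ, Q₁ ≠ 0 ∧ PosCoeffs Q₁ ∧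
      PosCoeffs ((X ^ 2 - C (2 * r * Real.cos φ) * X + C (r ^ 2)) * Q₁) := by
  have hc : 0 < Real.cos φ := Real.cos_pos_of_mem_Ioo ⟨by linarith, hφ₁⟩
  have hc₁ : Real.cos φ < 1 := by
    simpa using Real.cos_lt_cos_of_nonneg_of_le_pi_div_two le_rfl hφ₁.le hφ₀
  obtain ⟨n, hn⟩ := exists_nat_gt (2 / (1 - Real.cos φ))
  rw [div_lt_iff₀' (by linarith)] at hn
  exact ⟨(X + C r) ^ n, (monic_X_add_C r).pow n |>.ne_zero, posCoeffs_X_add_C_pow r hr n,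
    posCoeffs_quadratic_mul_X_add_C_pow r _ hr hc.le n (by linarith)⟩
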